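/- For every t ∈ ℂ, every positive integer m and every x ∈ ℤ: Σ_{γ ∈ mℤ} I_{x+γ}(t) = (1/m) Σ_{j=0}^{m−1} exp(t cos(2πj/m)) e^{2πi x j/m}. -/

import Mathlib

open scoped Real
open Complex

/-- The modified Bessel function of the first kind with integer order,
`I_x(t) = (1/π) ∫₀^π e^{t cos θ} cos(xθ) dθ`. -/
noncomputable def besselI (x : ℝ) (t : ℂ) : ℂ :=
  (Real.pi : ℂ)⁻¹ * ∫ θ in (0:ℝ)..Real.pi, Complex.exp (t * Real.cos θ) * (Real.cos (x * θ) : ℂ)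

lemma besselI_integrand_continuous (n : ℝ) (t : ℂ) :
    Continuous fun θ : ℝ => Complex.exp (t * Real.cos θ) * (Real.cos (n * θ) : ℂ) := by
  fun_prop

lemma norm_besselI_le (n : ℝ) (t : ℂ) : ‖besselI n t‖ ≤ Real.exp ‖t‖ := by
  have h : ‖∫ θ in (0:ℝ)..Real.pi, Complex.exp (t * Real.cos θ) * (Real.cos (n * θ) : ℂ)‖ ≤
      Real.exp ‖t‖ * |Real.pi - 0| := by
    refine intervalIntegral.norm_integral_le_of_norm_le_const fun θ _ => ?_
    rw [norm_mul, ← mul_one (Real.exp ‖t‖)]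
    refine mul_le_mul ?_ ?_ (norm_nonneg _) (Real.exp_nonneg _)
    · refine (Complex.norm_exp_le_exp_norm _).trans (Real.exp_le_exp.mpr ?_)
      rw [norm_mul, Complex.norm_real]
      exact mul_le_of_le_one_right (norm_nonneg _) (Real.abs_cos_le_one θ)
    · rw [Complex.norm_real]
      exact Real.abs_cos_le_one _
  rw [sub_zero, abs_of_pos Real.pi_pos] at h
  rw [besselI, norm_mul, norm_inv, Complex.norm_real, Real.norm_of_nonneg Real.pi_pos.le,
    inv_mul_le_iff₀ Real.pi_pos]
  linarith

/-- The three-term recurrence `I_{n-1}(t) - I_{n+1}(t) = (2n/t) I_n(t)`. -/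
lemma two_mul_int_mul_besselI (n : ℤ) (t : ℂ) :
    2 * n * besselI n t = t * (besselI (n - 1) t - besselI (n + 1) t) := by
  have hderiv : ∀ θ : ℝ, HasDerivAt
      (fun θ : ℝ => Complex.exp (t * Real.cos θ) * (Real.sin (n * θ) : ℂ))
      (Complex.exp (t * Real.cos θ) * (t * (-Real.sin θ : ℝ)) * (Real.sin (n * θ) : ℂ) +
        Complex.exp (t * Real.cos θ) * (Real.cos (n * θ) * (n * 1) : ℝ)) θ := by
    intro θ
    exact (((Real.hasDerivAt_cos θ).ofReal_comp.const_mul t).cexp).mul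
      (((hasDerivAt_id θ).const_mul (n : ℝ)).sin.ofReal_comp)
  have hint := intervalIntegral.integral_eq_sub_of_hasDerivAt (a := 0) (b := Real.pi)
    (fun θ _ => hderiv θ) (Continuous.intervalIntegrable (by fun_prop) _ _)
  have hzero : ∀ θ : ℝ,
      2 * (Complex.exp (t * Real.cos θ) * (t * (-Real.sin θ : ℝ)) * (Real.sin (n * θ) : ℂ) +
        Complex.exp (t * Real.cos θ) * (Real.cos (n * θ) * (n * 1) : ℝ)) =
      2 * n * (Complex.exp (t * Real.cos θ) * (Real.cos (n * θ) : ℂ)) -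
      t * (Complex.exp (t * Real.cos θ) * (Real.cos ((n - 1) * θ) : ℂ) -
        Complex.exp (t * Real.cos θ) * (Real.cos ((n + 1) * θ) : ℂ)) := by
    intro θ
    rw [sub_mul, add_mul, one_mul, Real.cos_sub, Real.cos_add]
    push_cast
    ring
  have hI := fun k : ℝ => (besselI_integrand_continuous k t).intervalIntegrable
    (μ := MeasureTheory.volume) 0 Real.pi
  have h2 := congrArg (2 * ·) hint
  simp only [← intervalIntegral.integral_const_mul, hzero] at h2
  rw [intervalIntegral.integral_sub ((hI _).const_mul _) (((hI _).sub (hI _)).const_mul _),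
    intervalIntegral.integral_const_mul, intervalIntegral.integral_const_mul,
    intervalIntegral.integral_sub (hI _) (hI _), Real.sin_int_mul_pi] at h2
  simp only [mul_zero, Real.sin_zero, Complex.ofReal_zero, sub_zero] at h2
  rw [besselI, besselI, besselI]
  linear_combination (Real.pi : ℂ)⁻¹ * h2

lemma norm_int_mul_besselI_le (n : ℤ) (t : ℂ) :
    ‖n * besselI n t‖ ≤ ‖t‖ * Real.exp ‖t‖ := by
  have h : n * besselI n t = t * ((besselI (n - 1) t - besselI (n + 1) t) / 2) := by
    linear_combination two_mul_int_mul_besselI n t / 2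
  rw [h, norm_mul, norm_div, Complex.norm_ofNat]
  gcongr
  linarith [norm_sub_le (besselI (n - 1) t) (besselI (n + 1) t), norm_besselI_le (n - 1) t,
    norm_besselI_le (n + 1) t]

lemma norm_int_sq_mul_besselI_le (n : ℤ) (t : ℂ) :
    ‖(n : ℂ) ^ 2 * besselI n t‖ ≤ ‖t‖ * ((‖t‖ + 1) * Real.exp ‖t‖) := by
  have h : (n : ℂ) ^ 2 * besselI n t =
      t * ((((n - 1 : ℤ) * besselI (n - 1 : ℤ) t + besselI (n - 1 : ℤ) t) -
        ((n + 1 : ℤ) * besselI (n + 1 : ℤ) t - besselI (n + 1 : ℤ) t)) / 2) := by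
    push_cast
    linear_combination n * two_mul_int_mul_besselI n t / 2
  rw [h, norm_mul, norm_div, Complex.norm_ofNat]
  gcongr
  have h₁ := norm_sub_le
    ((n - 1 : ℤ) * besselI (n - 1 : ℤ) t + besselI (n - 1 : ℤ) t)
    ((n + 1 : ℤ) * besselI (n + 1 : ℤ) t - besselI (n + 1 : ℤ) t)
  have h₂ := norm_add_le ((n - 1 : ℤ) * besselI (n - 1 : ℤ) t) (besselI (n - 1 : ℤ) t)
  have h₃ := norm_sub_le ((n + 1 : ℤ) * besselI (n + 1 : ℤ) t) (besselI (n + 1 : ℤ) t)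
  linarith [norm_int_mul_besselI_le (n - 1) t, norm_int_mul_besselI_le (n + 1) t,
    norm_besselI_le (n - 1 : ℤ) t, norm_besselI_le (n + 1 : ℤ) t]

lemma summable_besselI (t : ℂ) : Summable fun n : ℤ => besselI n t := by
  refine Summable.of_norm_bounded_eventually
    (g := fun n : ℤ => ‖t‖ * ((‖t‖ + 1) * Real.exp ‖t‖) * (1 / (n : ℝ) ^ 2))
    ((Real.summable_one_div_int_pow.mpr one_lt_two).mul_left _) ?_
  filter_upwards [(Set.finite_singleton (0 : ℤ)).compl_mem_cofinite] with n hn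
  have hpos : (0 : ℝ) < (n : ℝ) ^ 2 := by
    have : (n : ℝ) ≠ 0 := by exact_mod_cast hn
    positivity
  rw [mul_one_div, le_div_iff₀ hpos]
  have h := norm_int_sq_mul_besselI_le n t
  rw [norm_mul, norm_pow, Complex.norm_intCast, sq_abs] at h
  linarith

/-- The function `θ ↦ e^{t cos θ}` on the circle of length `2π`. -/
noncomputable def expMulCos (t : ℂ) : C(AddCircle (2 * Real.pi), ℂ) where
  toFun θ := Complex.exp (t * (Real.Angle.cos θ : ℝ))
  continuous_toFun := by
    have h : Continuous fun θ : AddCircle (2 * Real.pi) => Real.Angle.cos θ :=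
      Real.Angle.continuous_cos
    fun_prop

lemma expMulCos_coe (t : ℂ) (θ : ℝ) :
    expMulCos t (θ : AddCircle (2 * Real.pi)) = Complex.exp (t * Real.cos θ) :=
  rfl

lemma fourier_two_pi_coe (n : ℤ) (θ : ℝ) :
    fourier n (θ : AddCircle (2 * Real.pi)) = Complex.exp (n * θ * I) := by
  rw [fourier_coe_apply]
  congr 1
  have : (Real.pi : ℂ) ≠ 0 := by exact_mod_cast Real.pi_ne_zero
  push_cast
  field_simp

lemma fourierCoeff_expMulCos [Fact (0 < 2 * Real.pi)] (t : ℂ) (n : ℤ) :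
    fourierCoeff (expMulCos t) n = besselI n t := by
  have hcont : Continuous fun θ : ℝ =>
      Complex.exp ((-n : ℤ) * θ * I) * Complex.exp (t * Real.cos θ) := by fun_prop
  have hcont' : Continuous fun θ : ℝ =>
      Complex.exp ((-n : ℤ) * (-θ : ℝ) * I) * Complex.exp (t * Real.cos (-θ)) := by fun_prop
  rw [fourierCoeff_eq_intervalIntegral _ _ (-Real.pi)]
  simp only [fourier_two_pi_coe, expMulCos_coe, smul_eq_mul]
  rw [show -Real.pi + 2 * Real.pi = Real.pi by ring,
    ← intervalIntegral.integral_add_adjacent_intervals (b := 0)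
      (hcont.intervalIntegrable _ _) (hcont.intervalIntegrable _ _),
    ← neg_zero, ← intervalIntegral.integral_comp_neg (a := 0) (b := Real.pi)
      (fun θ : ℝ => Complex.exp ((-n : ℤ) * θ * I) * Complex.exp (t * Real.cos θ)), neg_zero,
    ← intervalIntegral.integral_add (hcont'.intervalIntegrable _ _)
      (hcont.intervalIntegrable _ _)]
  have hsum : ∀ θ : ℝ,
      Complex.exp ((-n : ℤ) * (-θ : ℝ) * I) * Complex.exp (t * Real.cos (-θ)) +
        Complex.exp ((-n : ℤ) * θ * I) * Complex.exp (t * Real.cos θ) =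
      2 * (Complex.exp (t * Real.cos θ) * (Real.cos (n * θ) : ℂ)) := by
    intro θ
    rw [Real.cos_neg, Complex.ofReal_cos (n * θ), Complex.cos]
    push_cast
    ring_nf
  simp only [hsum]
  rw [intervalIntegral.integral_const_mul, besselI, Complex.real_smul]
  push_cast
  ring

/-- The generating function `∑ I_n(t) e^{-inθ} = e^{t cos θ}`. -/
lemma hasSum_besselI_mul_exp (t : ℂ) (θ : ℝ) :
    HasSum (fun n : ℤ => besselI n t * Complex.exp (-(n * θ * I)))
      (Complex.exp (t * Real.cos θ)) := by
  have : Fact (0 < 2 * Real.pi) := ⟨Real.two_pi_pos⟩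
  have hcoeff : fourierCoeff (expMulCos t) = fun n : ℤ => besselI n t :=
    funext (fourierCoeff_expMulCos t)
  have h := has_pointwise_sum_fourier_series_of_summable (f := expMulCos t)
    (hcoeff ▸ summable_besselI t) ((-θ : ℝ) : AddCircle (2 * Real.pi))
  rw [expMulCos_coe, Real.cos_neg] at h
  simpa only [hcoeff, fourier_two_pi_coe, smul_eq_mul, Complex.ofReal_neg, mul_neg, neg_mul]
    using h

lemma sum_exp_two_pi_mul_div (m : ℕ) (hm : 0 < m) (d : ℤ) :
    ∑ j ∈ Finset.range m, Complex.exp (2 * Real.pi * I * d * j / m) =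
      if (m : ℤ) ∣ d then (m : ℂ) else 0 := by
  have hm' : (m : ℂ) ≠ 0 := by exact_mod_cast hm.ne'
  have hpow : ∀ j : ℕ, Complex.exp (2 * Real.pi * I * d * j / m) =
      Complex.exp (2 * Real.pi * I * d / m) ^ j := by
    intro j
    rw [← Complex.exp_nat_mul]
    congr 1
    ring
  simp only [hpow]
  have hone : Complex.exp (2 * Real.pi * I * d / m) = 1 ↔ (m : ℤ) ∣ d := by
    rw [Complex.exp_eq_one_iff]
    refine exists_congr fun k => ?_
    have hpi := Complex.two_pi_I_ne_zero
    rw [div_eq_iff hm', show (k : ℂ) * (2 * Real.pi * I) * m = 2 * Real.pi * I * (m * k) by ring,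
      mul_right_inj' hpi]
    norm_cast
  split_ifs with h
  · simp [hone.mpr h]
  · have hroot : Complex.exp (2 * Real.pi * I * d / m) ^ m = 1 := by
      rw [← hpow, mul_div_cancel_right₀ _ hm', Complex.exp_eq_one_iff]
      exact ⟨d, by ring⟩
    have hne := sub_ne_zero.mpr (mt hone.mp h)
    have := geom_sum_mul (Complex.exp (2 * Real.pi * I * d / m)) m
    rw [hroot, sub_self] at this
    exact (mul_eq_zero.mp this).resolve_right hne

/-- for `t ∈ ℂ`, `m ≥ 1`, `x ∈ ℤ`:
`Σ_{γ ∈ mℤ} I_{x+γ}(t) = (1/m) Σ_{j=0}^{m-1} exp(t cos(2πj/m)) e^{2πi x j/m}`. -/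
theorem besselI_lattice_sum_one_dim (t : ℂ) (m : ℕ) (hm : 0 < m) (x : ℤ) :
    ∑' k : ℤ, besselI ((x : ℝ) + (m : ℝ) * (k : ℝ)) t =
      (m : ℂ)⁻¹ * ∑ j ∈ Finset.range m,
        Complex.exp (t * Real.cos (2 * Real.pi * (j : ℝ) / (m : ℝ))) *
          Complex.exp (2 * Real.pi * I * (x : ℝ) * (j : ℝ) / (m : ℝ)) := by
  have hm' : (m : ℂ) ≠ 0 := by exact_mod_cast hm.ne'
  have hsum := (hasSum_sum fun j (_ : j ∈ Finset.range m) =>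
    (hasSum_besselI_mul_exp t (2 * Real.pi * j / m)).mul_right
      (Complex.exp (2 * Real.pi * I * (x : ℝ) * (j : ℝ) / (m : ℝ)))).mul_left (m : ℂ)⁻¹
  have hterm : ∀ n : ℤ, (m : ℂ)⁻¹ * ∑ j ∈ Finset.range m,
      besselI n t * Complex.exp (-(n * (2 * Real.pi * j / m : ℝ) * I)) *
        Complex.exp (2 * Real.pi * I * (x : ℝ) * (j : ℝ) / (m : ℝ)) =
      if (m : ℤ) ∣ x - n then besselI n t else 0 := by
    intro n
    have hexp : ∀ j : ℕ, besselI n t * Complex.exp (-(n * (2 * Real.pi * j / m : ℝ) * I)) *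
        Complex.exp (2 * Real.pi * I * (x : ℝ) * (j : ℝ) / (m : ℝ)) =
        besselI n t * Complex.exp (2 * Real.pi * I * (x - n : ℤ) * j / m) := by
      intro j
      rw [mul_assoc, ← Complex.exp_add]
      push_cast
      ring_nf
    simp only [hexp]
    rw [← Finset.mul_sum, sum_exp_two_pi_mul_div m hm]
    split_ifs
    · field_simp
    · simp
  simp only [hterm] at hsum
  have hinj : Function.Injective fun k : ℤ => x + m * k := fun a b hab =>
    mul_left_cancel₀ (by exact_mod_cast hm.ne') (add_left_cancel hab)
  rw [← hinj.hasSum_iff] at hsum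
  · rw [← hsum.tsum_eq]
    refine tsum_congr fun k => ?_
    simp
  · intro n hn
    refine if_neg fun ⟨k, hk⟩ => hn ⟨-k, ?_⟩
    simp only [mul_neg]
    linarith
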